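/- Suppose τ* ∈ (0,∞) maximizes over τ ∈ [0,∞) the function G(τ) := τ²·E_{Y ∼ N(τ,1)}[(1/(exp(2τY)+1))²], and define the logistic rule δ*(y) := exp(2τ*y)/(exp(2τ*y)+1). Then δ* is minimax optimal for mean square regret in the Gaussian experiment: for every measurable rule δ : ℝ → [0,1], sup_{τ∈ℝ} R_sq(δ*, τ) ≤ sup_{τ∈ℝ} R_sq(δ, τ), where R_sq(δ, τ) := τ²·∫ (𝟙{τ ≥ 0} − δ(y))² dN(τ,1)(y). -/

import Mathlib

open MeasureTheory ProbabilityTheory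

/-- Mean square regret of a rule `δ` at state `τ` in the Gaussian experiment `N(τ,1)`. -/
noncomputable def Rsq (δ : ℝ → ℝ) (τ : ℝ) : ℝ :=
  τ ^ 2 * ∫ y, ((if 0 ≤ τ then (1:ℝ) else 0) - δ y) ^ 2 ∂(gaussianReal τ 1)

/-- `G(τ) = τ²·E_{Y∼N(τ,1)}[(1/(exp(2τY)+1))²]`. -/
noncomputable def Gfun (τ : ℝ) : ℝ :=
  τ ^ 2 * ∫ y, (1 / (Real.exp (2 * τ * y) + 1)) ^ 2 ∂(gaussianReal τ 1)

/-- The logistic rule `δ*(y) = exp(2τ*y)/(exp(2τ*y)+1)`. -/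
noncomputable def logisticRule (t y : ℝ) : ℝ :=
  Real.exp (2 * t * y) / (Real.exp (2 * t * y) + 1)

lemma integrable_gaussianReal_iff {f : ℝ → ℝ} {μ : ℝ} :
    Integrable f (gaussianReal μ 1) ↔ Integrable (fun y ↦ gaussianPDFReal μ 1 y * f y) := by
  rw [gaussianReal_of_var_ne_zero _ one_ne_zero,
    integrable_withDensity_iff_integrable_smul' (measurable_gaussianPDF _ _)
      (ae_of_all _ fun _ ↦ gaussianPDF_lt_top)]
  simp

lemma integral_gaussianReal_eq {f : ℝ → ℝ} {μ : ℝ} :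
    ∫ y, f y ∂(gaussianReal μ 1) = ∫ y, gaussianPDFReal μ 1 y * f y := by
  simp [integral_gaussianReal_eq_integral_smul]

/-- A measurable function of at most linear growth is integrable against a Gaussian measure. -/
lemma integrable_gaussianReal_of_abs_le {f : ℝ → ℝ} (hf : Measurable f) {A B : ℝ}
    (h : ∀ y, |f y| ≤ A + B * |y|) (μ : ℝ) : Integrable f (gaussianReal μ 1) := by
  have hid : Integrable (fun y : ℝ ↦ |y|) (gaussianReal μ 1) := by
    have := (memLp_id_gaussianReal (μ := μ) (v := 1) 1).integrable (by simp)
    exact this.abs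
  exact ((integrable_const A).add (hid.const_mul B)).mono' hf.aestronglyMeasurable
    (ae_of_all _ h)

lemma integral_gaussianReal_shift (f : ℝ → ℝ) (τ : ℝ) :
    ∫ y, f y ∂(gaussianReal τ 1) = ∫ x, f (x + τ) ∂(gaussianReal 0 1) := by
  have h := gaussianReal_map_add_const (μ := 0) (v := 1) τ
  rw [zero_add] at h
  rw [← h, (measurableEmbedding_addRight τ).integral_map]

lemma integral_gaussianReal_neg (f : ℝ → ℝ) (τ : ℝ) :
    ∫ y, f y ∂(gaussianReal (-τ) 1) = ∫ y, f (-y) ∂(gaussianReal τ 1) := by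
  rw [← gaussianReal_map_neg]
  exact (MeasurableEquiv.neg ℝ).measurableEmbedding.integral_map f

lemma hasDerivAt_gaussianPDFReal (μ y : ℝ) :
    HasDerivAt (gaussianPDFReal μ 1) (-(y - μ) * gaussianPDFReal μ 1 y) y := by
  have h : HasDerivAt (fun y : ℝ ↦ -(y - μ) ^ 2 / 2) (-(y - μ)) y := by
    have := ((((hasDerivAt_id y).sub_const μ).pow 2).neg).div_const 2
    refine this.congr_deriv ?_
    simp
    ring
  have h2 := (h.exp).const_mul (√(2 * Real.pi))⁻¹
  unfold gaussianPDFReal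
  simp only [NNReal.coe_one, mul_one]
  refine h2.congr_deriv ?_
  ring

lemma gaussianPDFReal_eq_mul_exp (μ ν y y₀ : ℝ) :
    gaussianPDFReal μ 1 y * gaussianPDFReal ν 1 y₀ =
      gaussianPDFReal ν 1 y * gaussianPDFReal μ 1 y₀ * Real.exp ((μ - ν) * (y - y₀)) := by
  simp only [gaussianPDFReal, NNReal.coe_one, mul_one]
  rw [mul_mul_mul_comm, mul_mul_mul_comm _ _ _ (Real.exp (-(y₀ - μ) ^ 2 / 2)), mul_assoc _ _
    (Real.exp ((μ - ν) * (y - y₀))), ← Real.exp_add, ← Real.exp_add, ← Real.exp_add]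
  congr 2
  ring

/-- Gaussian integration by parts (Stein's identity) for bounded functions with bounded derivative. -/
lemma integral_gaussianReal_stein {f f' : ℝ → ℝ} (hf : ∀ y, HasDerivAt f (f' y) y)
    {A B : ℝ} (hA : ∀ y, |f y| ≤ A) (hB : ∀ y, |f' y| ≤ B) (hf'm : Measurable f') (τ : ℝ) :
    ∫ y, (f' y - (y - τ) * f y) ∂(gaussianReal τ 1) = 0 := by
  have hfm : Measurable f :=
    (continuous_iff_continuousAt.2 fun y ↦ (hf y).continuousAt).measurable
  have h1 : Integrable (fun y ↦ f' y - (y - τ) * f y) (gaussianReal τ 1) := by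
    refine integrable_gaussianReal_of_abs_le (A := B + |τ| * A) (B := A) (by fun_prop) ?_ τ
    intro y
    have hy : |y - τ| ≤ |y| + |τ| := abs_sub y τ
    calc |f' y - (y - τ) * f y| ≤ |f' y| + |(y - τ) * f y| := abs_sub _ _
      _ ≤ B + (|y| + |τ|) * A := by
        rw [abs_mul]
        gcongr
        · exact hB y
        · exact hA y
      _ = _ := by ring
  have h2 : Integrable f (gaussianReal τ 1) :=
    integrable_gaussianReal_of_abs_le (A := A) (B := 0) hfm (by simpa using hA) τ
  rw [integral_gaussianReal_eq]
  rw [integrable_gaussianReal_iff] at h1 h2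
  refine integral_eq_zero_of_hasDerivAt_of_integrable (fun y ↦ ?_) h1 h2
  refine ((hasDerivAt_gaussianPDFReal τ y).mul (hf y)).congr_deriv ?_
  ring

/-- If `k` changes sign once, from `+` to `-`, and has mean zero under `N(τ₀,1)`, then its mean is
nonpositive for larger and nonnegative for smaller Gaussian means. -/
lemma integral_gaussianReal_sign {k : ℝ → ℝ} (hk : ∀ τ, Integrable k (gaussianReal τ 1)) {y₀ : ℝ}
    (hpos : ∀ y ≤ y₀, 0 ≤ k y) (hneg : ∀ y, y₀ ≤ y → k y ≤ 0) {τ₀ : ℝ}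
    (h0 : ∫ y, k y ∂(gaussianReal τ₀ 1) = 0) (τ : ℝ) :
    (τ - τ₀) * ∫ y, k y ∂(gaussianReal τ 1) ≤ 0 := by
  have hp0 : 0 < gaussianPDFReal τ₀ 1 y₀ := gaussianPDFReal_pos _ _ _ one_ne_zero
  have hp : 0 < gaussianPDFReal τ 1 y₀ := gaussianPDFReal_pos _ _ _ one_ne_zero
  have key : ∀ y, gaussianPDFReal τ₀ 1 y₀ * ((τ - τ₀) * (gaussianPDFReal τ 1 y * k y)) ≤
      gaussianPDFReal τ 1 y₀ * ((τ - τ₀) * (gaussianPDFReal τ₀ 1 y * k y)) := by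
    intro y
    have h := gaussianPDFReal_eq_mul_exp τ τ₀ y y₀
    have hpy : 0 < gaussianPDFReal τ₀ 1 y := gaussianPDFReal_pos _ _ _ one_ne_zero
    have hc := mul_pos hpy hp
    have hs : (τ - τ₀) * k y * (Real.exp ((τ - τ₀) * (y - y₀)) - 1) ≤ 0 := by
      have e1 : 0 ≤ (τ - τ₀) * (y - y₀) → 0 ≤ Real.exp ((τ - τ₀) * (y - y₀)) - 1 := fun h ↦ by
        linarith [Real.one_le_exp h]
      have e2 : (τ - τ₀) * (y - y₀) ≤ 0 → Real.exp ((τ - τ₀) * (y - y₀)) - 1 ≤ 0 := fun h ↦ by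
        linarith [Real.exp_le_one_iff.2 h]
      rcases le_total y y₀ with hy | hy <;> rcases le_total τ τ₀ with ht | ht
      · exact mul_nonpos_of_nonpos_of_nonneg
          (mul_nonpos_of_nonpos_of_nonneg (by linarith) (hpos y hy))
          (e1 (mul_nonneg_of_nonpos_of_nonpos (by linarith) (by linarith)))
      · exact mul_nonpos_of_nonneg_of_nonpos
          (mul_nonneg (by linarith) (hpos y hy))
          (e2 (mul_nonpos_of_nonneg_of_nonpos (by linarith) (by linarith)))
      · exact mul_nonpos_of_nonneg_of_nonpos
          (mul_nonneg_of_nonpos_of_nonpos (by linarith) (hneg y hy))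
          (e2 (mul_nonpos_of_nonpos_of_nonneg (by linarith) (by linarith)))
      · exact mul_nonpos_of_nonpos_of_nonneg
          (mul_nonpos_of_nonneg_of_nonpos (by linarith) (hneg y hy))
          (e1 (mul_nonneg (by linarith) (by linarith)))
    linear_combination (τ - τ₀) * k y * h +
      mul_nonpos_of_nonneg_of_nonpos hc.le hs
  have hint := fun τ ↦ integrable_gaussianReal_iff.1 (hk τ)
  have := integral_mono (((hint τ).const_mul (τ - τ₀)).const_mul _)
    (((hint τ₀).const_mul (τ - τ₀)).const_mul _) key
  simp only [integral_const_mul, ← integral_gaussianReal_eq, h0, mul_zero] at this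
  by_contra! hcon
  linarith [mul_pos hp0 hcon]

open Real in
lemma logisticRule_eq_sigmoid (t y : ℝ) : logisticRule t y = sigmoid (2 * t * y) := by
  rw [logisticRule, sigmoid_def, Real.exp_neg]
  have := Real.exp_pos (2 * t * y)
  field_simp

open Real in
lemma one_div_exp_add_one (u : ℝ) : 1 / (Real.exp u + 1) = 1 - sigmoid u := by
  rw [← sigmoid_neg, sigmoid_def, neg_neg, add_comm, one_div]

open Real in
lemma hasDerivAt_sigmoid_scaled (a y : ℝ) :
    HasDerivAt (fun y ↦ sigmoid (a * y)) (a * (sigmoid (a * y) * (1 - sigmoid (a * y)))) y := by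
  have h := (hasDerivAt_sigmoid (a * y)).comp y ((hasDerivAt_id y).const_mul a)
  refine h.congr_deriv ?_
  simp [mul_comm]

/-- Second-moment error of the logistic rule with parameter `a` at state `τ`, as a Gaussian
integral. -/
noncomputable def sqErr (a τ : ℝ) : ℝ :=
  ∫ y, (1 - Real.sigmoid (2 * a * y)) ^ 2 ∂(gaussianReal τ 1)

lemma measurable_sigmoid : Measurable Real.sigmoid := continuous_sigmoid.measurable

lemma Gfun_eq (τ : ℝ) : Gfun τ = τ ^ 2 * sqErr τ τ := by
  simp only [Gfun, sqErr, one_div_exp_add_one]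

lemma integrable_sq_of_mem_Icc {f : ℝ → ℝ} (hf : Measurable f) (h : ∀ y, f y ∈ Set.Icc (0:ℝ) 1)
    (τ : ℝ) : Integrable (fun y ↦ f y ^ 2) (gaussianReal τ 1) := by
  refine integrable_gaussianReal_of_abs_le (A := 1) (B := 0) (by fun_prop) (fun y ↦ ?_) τ
  obtain ⟨h0, h1⟩ := h y
  rw [abs_of_nonneg (by positivity)]
  nlinarith

open Real in
/-- The logistic rule with parameter `τ` is Bayes for the symmetric two-point prior at `±τ`. -/
lemma two_mul_sqErr_le {δ : ℝ → ℝ} (hδ : Measurable δ) (h01 : ∀ y, δ y ∈ Set.Icc (0:ℝ) 1)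
    (τ : ℝ) : 2 * sqErr τ τ ≤
      ∫ y, (1 - δ y) ^ 2 ∂(gaussianReal τ 1) + ∫ y, δ y ^ 2 ∂(gaussianReal (-τ) 1) := by
  have hs : Measurable fun y ↦ sigmoid (2 * τ * y) := measurable_sigmoid.comp (by fun_prop)
  have hs01 : ∀ y, sigmoid (2 * τ * y) ∈ Set.Icc (0:ℝ) 1 :=
    fun y ↦ ⟨sigmoid_nonneg _, sigmoid_le_one _⟩
  have hsym : sqErr τ τ = ∫ y, sigmoid (2 * τ * y) ^ 2 ∂(gaussianReal (-τ) 1) := by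
    rw [integral_gaussianReal_neg, sqErr]
    simp only [mul_neg, sigmoid_neg]
  have hsub : ∀ {f : ℝ → ℝ}, (∀ y, f y ∈ Set.Icc (0:ℝ) 1) →
      ∀ y, 1 - f y ∈ Set.Icc (0:ℝ) 1 := fun hf y ↦ by
    obtain ⟨h0, h1⟩ := hf y
    exact ⟨by linarith, by linarith⟩
  have i1 := integrable_gaussianReal_iff.1
    (integrable_sq_of_mem_Icc (hs.const_sub 1) (hsub hs01) τ)
  have i2 := integrable_gaussianReal_iff.1 (integrable_sq_of_mem_Icc hs hs01 (-τ))
  have i3 := integrable_gaussianReal_iff.1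
    (integrable_sq_of_mem_Icc (hδ.const_sub 1) (hsub h01) τ)
  have i4 := integrable_gaussianReal_iff.1 (integrable_sq_of_mem_Icc hδ h01 (-τ))
  rw [two_mul]
  nth_rw 2 [hsym]
  rw [sqErr]
  simp only [integral_gaussianReal_eq]
  rw [← integral_add i1 i2, ← integral_add i3 i4]
  refine integral_mono (i1.add i2) (i3.add i4) fun y ↦ ?_
  have hp : 0 < gaussianPDFReal τ 1 y := gaussianPDFReal_pos _ _ _ one_ne_zero
  have hq : 0 < gaussianPDFReal (-τ) 1 y := gaussianPDFReal_pos _ _ _ one_ne_zero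
  have hpq : sigmoid (2 * τ * y) * gaussianPDFReal (-τ) 1 y =
      (1 - sigmoid (2 * τ * y)) * gaussianPDFReal τ 1 y := by
    have h := gaussianPDFReal_eq_mul_exp (-τ) τ y 0
    have h0 : gaussianPDFReal (-τ) 1 0 = gaussianPDFReal τ 1 0 := by simp [gaussianPDFReal]
    have hp0 : 0 < gaussianPDFReal τ 1 0 := gaussianPDFReal_pos _ _ _ one_ne_zero
    rw [h0, mul_right_comm] at h
    rw [mul_right_cancel₀ hp0.ne' h, ← sigmoid_neg, ← sigmoid_mul_rexp_neg]
    ring_nf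
  dsimp only
  set s := sigmoid (2 * τ * y)
  set p := gaussianPDFReal τ 1 y
  set q := gaussianPDFReal (-τ) 1 y
  have := mul_nonneg (add_pos hp hq).le (sq_nonneg (δ y - s))
  linear_combination this + 2 * (s - δ y) * hpq

open Real in
lemma sqErr_self_le (a τ : ℝ) : sqErr τ τ ≤ sqErr a τ := by
  have h := two_mul_sqErr_le (δ := fun y ↦ sigmoid (2 * a * y))
    (measurable_sigmoid.comp (by fun_prop)) (fun y ↦ ⟨sigmoid_nonneg _, sigmoid_le_one _⟩) τ
  rw [integral_gaussianReal_neg] at h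
  simp only [mul_neg, sigmoid_neg] at h
  rw [← sqErr] at h
  linarith

open Real in
/-- Differentiation of the error along an affine path of logistic parameters. -/
lemma hasDerivAt_sqErr (b c τ : ℝ) :
    HasDerivAt (fun t ↦ sqErr (b + c * t) t)
      (∫ x, -2 * (1 - sigmoid (2 * (b + c * τ) * (x + τ))) ^ 2 *
        sigmoid (2 * (b + c * τ) * (x + τ)) *
          (2 * c * (x + τ) + 2 * (b + c * τ)) ∂(gaussianReal 0 1)) τ := by
  have hshift : (fun t ↦ sqErr (b + c * t) t) = fun t ↦
      ∫ x, (1 - sigmoid (2 * (b + c * t) * (x + t))) ^ 2 ∂(gaussianReal 0 1) :=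
    funext fun t ↦ integral_gaussianReal_shift _ t
  rw [hshift]
  have hm := measurable_sigmoid
  refine (hasDerivAt_integral_of_dominated_loc_of_deriv_le (Metric.ball_mem_nhds τ one_pos)
    (F' := fun t x ↦ -2 * (1 - sigmoid (2 * (b + c * t) * (x + t))) ^ 2 *
        sigmoid (2 * (b + c * t) * (x + t)) * (2 * c * (x + t) + 2 * (b + c * t)))
    (bound := fun x ↦ 2 * (2 * |c| * (|x| + (|τ| + 1)) + 2 * (|b| + |c| * (|τ| + 1))))
    ?_ ?_ ?_ ?_ ?_ ?_).2
  · exact .of_forall fun t ↦ (by fun_prop : Measurable _).aestronglyMeasurable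
  · refine integrable_sq_of_mem_Icc (by fun_prop) (fun y ↦ ?_) 0
    constructor <;> linarith [sigmoid_nonneg (2 * (b + c * τ) * (y + τ)),
      sigmoid_le_one (2 * (b + c * τ) * (y + τ))]
  · exact (by fun_prop : Measurable _).aestronglyMeasurable
  · refine ae_of_all _ fun x t ht ↦ ?_
    have ht' : |t| ≤ |τ| + 1 := by
      have h1 : |t - τ| < 1 := by simpa [Real.dist_eq] using ht
      linarith [abs_sub_abs_le_abs_sub t τ]
    have h0 := sigmoid_nonneg (2 * (b + c * t) * (x + t))
    have h1 := sigmoid_le_one (2 * (b + c * t) * (x + t))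
    set s := sigmoid (2 * (b + c * t) * (x + t))
    rw [Real.norm_eq_abs, abs_mul]
    have e1 : |-2 * (1 - s) ^ 2 * s| ≤ 2 := by
      have : (1 - s) ^ 2 * s ≤ 1 := mul_le_one₀ (by nlinarith) h0 h1
      rw [mul_assoc, abs_mul, abs_of_nonneg (by positivity : 0 ≤ (1 - s) ^ 2 * s)]
      norm_num
      linarith
    have e2 : |2 * c * (x + t) + 2 * (b + c * t)| ≤
        2 * |c| * (|x| + (|τ| + 1)) + 2 * (|b| + |c| * (|τ| + 1)) := by
      refine (abs_add_le _ _).trans ?_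
      simp only [abs_mul, abs_two]
      gcongr
      · exact (abs_add_le _ _).trans (by gcongr)
      · exact (abs_add_le _ _).trans (by rw [abs_mul]; gcongr)
    gcongr
  · refine integrable_gaussianReal_of_abs_le
      (A := 2 * (2 * |c| * (|τ| + 1) + 2 * (|b| + |c| * (|τ| + 1)))) (B := 4 * |c|)
      (by fun_prop) (fun x ↦ ?_) 0
    rw [abs_of_nonneg (by positivity)]
    apply le_of_eq
    ring
  · refine ae_of_all _ fun x t _ ↦ ?_
    have hu : HasDerivAt (fun t ↦ 2 * (b + c * t) * (x + t))
        (2 * c * (x + t) + 2 * (b + c * t)) t := by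
      have := ((((hasDerivAt_id t).const_mul c).const_add b).const_mul 2).mul
        ((hasDerivAt_id t).const_add x)
      refine this.congr_deriv ?_
      simp
    have := (((hasDerivAt_sigmoid _).comp t hu).const_sub 1).pow 2
    refine this.congr_deriv ?_
    simp
    ring

/-- The integrand whose Gaussian mean is, up to the factor `τ`, the derivative of the regret of
the logistic rule. -/
noncomputable def regretScore (a y : ℝ) : ℝ :=
  2 * (1 - Real.sigmoid (2 * a * y)) ^ 2
    - 4 * a * y * ((1 - Real.sigmoid (2 * a * y)) ^ 2 * Real.sigmoid (2 * a * y))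
    - 8 * a ^ 2 * ((1 - Real.sigmoid (2 * a * y)) ^ 2 * Real.sigmoid (2 * a * y)
      * (3 * Real.sigmoid (2 * a * y) - 1))

open Real in
lemma integrable_regretScore (a τ : ℝ) : Integrable (regretScore a) (gaussianReal τ 1) := by
  have hm := measurable_sigmoid
  refine integrable_gaussianReal_of_abs_le (A := 2 + 16 * a ^ 2) (B := 4 * |a|)
    (by unfold regretScore; fun_prop) (fun y ↦ ?_) τ
  rw [regretScore]
  have h0 := sigmoid_nonneg (2 * a * y)
  have h1 := sigmoid_le_one (2 * a * y)
  set s := sigmoid (2 * a * y)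
  have hw0 : 0 ≤ (1 - s) ^ 2 := by positivity
  have hw1 : (1 - s) ^ 2 ≤ 1 := by nlinarith
  have hv0 : 0 ≤ (1 - s) ^ 2 * s := by positivity
  have hv1 : (1 - s) ^ 2 * s ≤ 1 := mul_le_one₀ hw1 h0 h1
  have e1 : |2 * (1 - s) ^ 2| ≤ 2 := by rw [abs_of_nonneg (by positivity)]; linarith
  have e2 : |4 * a * y * ((1 - s) ^ 2 * s)| ≤ 4 * |a| * |y| := by
    rw [abs_mul, abs_of_nonneg hv0, abs_mul, abs_mul, abs_of_pos (by norm_num : (0:ℝ) < 4)]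
    exact mul_le_of_le_one_right (by positivity) hv1
  have e3 : |8 * a ^ 2 * ((1 - s) ^ 2 * s * (3 * s - 1))| ≤ 8 * a ^ 2 * (1 * 2) := by
    rw [abs_mul, abs_of_nonneg (by positivity : 0 ≤ 8 * a ^ 2), abs_mul, abs_of_nonneg hv0]
    gcongr
    exact abs_le.2 ⟨by linarith, by linarith⟩
  refine (abs_sub _ _).trans ?_
  linarith [abs_sub (2 * (1 - s) ^ 2) (4 * a * y * ((1 - s) ^ 2 * s))]

open Real in
lemma integral_regretScore (a τ : ℝ) :
    ∫ y, regretScore a y ∂(gaussianReal τ 1) = 2 * sqErr a τ +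
      τ * ∫ y, -4 * a * ((1 - sigmoid (2 * a * y)) ^ 2 * sigmoid (2 * a * y))
        ∂(gaussianReal τ 1) := by
  have hm := measurable_sigmoid
  have hb : ∀ y, 0 ≤ (1 - sigmoid (2 * a * y)) ^ 2 * sigmoid (2 * a * y) ∧
      (1 - sigmoid (2 * a * y)) ^ 2 * sigmoid (2 * a * y) ≤ 1 := fun y ↦ by
    have h0 := sigmoid_nonneg (2 * a * y)
    have h1 := sigmoid_le_one (2 * a * y)
    exact ⟨by positivity, mul_le_one₀ (by nlinarith) h0 h1⟩
  have hf : ∀ y, HasDerivAt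
      (fun y ↦ -4 * a * ((1 - sigmoid (2 * a * y)) ^ 2 * sigmoid (2 * a * y)))
      (8 * a ^ 2 * ((1 - sigmoid (2 * a * y)) ^ 2 * sigmoid (2 * a * y)
        * (3 * sigmoid (2 * a * y) - 1))) y := fun y ↦ by
    have h := hasDerivAt_sigmoid_scaled (2 * a) y
    have := (((h.const_sub 1).pow 2).mul h).const_mul (-4 * a)
    refine this.congr_deriv ?_
    simp
    ring
  have hA : ∀ y, |-4 * a * ((1 - sigmoid (2 * a * y)) ^ 2 * sigmoid (2 * a * y))| ≤ 4 * |a| :=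
    fun y ↦ by
      rw [abs_mul, abs_of_nonneg (hb y).1, abs_mul]
      norm_num
      exact mul_le_of_le_one_right (by positivity) (hb y).2
  have hB : ∀ y, |8 * a ^ 2 * ((1 - sigmoid (2 * a * y)) ^ 2 * sigmoid (2 * a * y)
      * (3 * sigmoid (2 * a * y) - 1))| ≤ 8 * a ^ 2 * (1 * 2) := fun y ↦ by
    rw [abs_mul, abs_of_nonneg (by positivity : 0 ≤ 8 * a ^ 2), abs_mul, abs_of_nonneg (hb y).1]
    gcongr
    · exact (hb y).2
    · exact abs_le.2 ⟨by linarith [sigmoid_nonneg (2 * a * y)],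
        by linarith [sigmoid_le_one (2 * a * y)]⟩
  have hstein := integral_gaussianReal_stein hf hA hB (by fun_prop) τ
  have i1 : Integrable (fun y ↦ 2 * (1 - sigmoid (2 * a * y)) ^ 2) (gaussianReal τ 1) := by
    refine (integrable_sq_of_mem_Icc (by fun_prop) (fun y ↦ ?_) τ).const_mul 2
    constructor <;> linarith [sigmoid_nonneg (2 * a * y), sigmoid_le_one (2 * a * y)]
  have i2 : Integrable
      (fun y ↦ τ * (-4 * a * ((1 - sigmoid (2 * a * y)) ^ 2 * sigmoid (2 * a * y))))
      (gaussianReal τ 1) :=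
    (integrable_gaussianReal_of_abs_le (A := 4 * |a|) (B := 0) (by fun_prop)
      (by simpa using hA) τ).const_mul τ
  have i12 := i1.add i2
  have hsub := integral_sub i12 (integrable_regretScore a τ)
  have hadd := integral_add i1 i2
  simp only [Pi.add_apply] at hsub
  rw [hadd, integral_const_mul, integral_const_mul] at hsub
  rw [sqErr]
  have hcongr : ∫ y, (2 * (1 - sigmoid (2 * a * y)) ^ 2 +
      τ * (-4 * a * ((1 - sigmoid (2 * a * y)) ^ 2 * sigmoid (2 * a * y))) - regretScore a y)
        ∂(gaussianReal τ 1) = 0 := by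
    rw [← hstein]
    congr 1 with y
    rw [regretScore]
    ring
  rw [hcongr] at hsub
  linarith

open Real in
lemma hasDerivAt_sq_mul_sqErr (a τ : ℝ) :
    HasDerivAt (fun t ↦ t ^ 2 * sqErr a t)
      (τ * ∫ y, regretScore a y ∂(gaussianReal τ 1)) τ := by
  have h := hasDerivAt_sqErr a 0 τ
  simp only [zero_mul, add_zero, mul_zero, zero_add] at h
  refine ((hasDerivAt_pow 2 τ).mul h).congr_deriv ?_
  rw [integral_regretScore, integral_gaussianReal_shift (fun y ↦ -4 * a * _)]
  have : ∀ x : ℝ, -2 * (1 - sigmoid (2 * a * (x + τ))) ^ 2 * sigmoid (2 * a * (x + τ)) * (2 * a) =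
      -4 * a * ((1 - sigmoid (2 * a * (x + τ))) ^ 2 * sigmoid (2 * a * (x + τ))) :=
    fun x ↦ by ring
  simp only [this]
  simp
  ring

lemma differentiableAt_Gfun (τ : ℝ) : DifferentiableAt ℝ Gfun τ := by
  have h := hasDerivAt_sqErr 0 1 τ
  simp only [zero_add, one_mul] at h
  have hG : Gfun = fun t ↦ t ^ 2 * sqErr t t := funext Gfun_eq
  rw [hG]
  exact (differentiableAt_pow 2).mul h.differentiableAt

open Real in
/-- The score of the logistic rule changes sign exactly once, from `+` to `-`. -/
lemma exists_regretScore_sign {a : ℝ} (ha : 0 < a) :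
    ∃ y₀, (∀ y ≤ y₀, 0 ≤ regretScore a y) ∧ ∀ y, y₀ ≤ y → regretScore a y ≤ 0 := by
  set K : ℝ → ℝ := fun y ↦
    (sigmoid (2 * a * y))⁻¹ - 2 * a * y - 4 * a ^ 2 * (3 * sigmoid (2 * a * y) - 1) with hK
  have hfac : ∀ y, regretScore a y =
      2 * ((1 - sigmoid (2 * a * y)) ^ 2 * sigmoid (2 * a * y)) * K y := fun y ↦ by
    have := (sigmoid_pos (2 * a * y)).ne'
    rw [regretScore, hK]
    field_simp
    ring
  have hw : ∀ y, 0 ≤ 2 * ((1 - sigmoid (2 * a * y)) ^ 2 * sigmoid (2 * a * y)) := fun y ↦ by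
    have := sigmoid_nonneg (2 * a * y)
    positivity
  have hanti : Antitone K := fun x y hxy ↦ by
    have h2 : 2 * a * x ≤ 2 * a * y := by gcongr
    have hs := sigmoid_le h2
    have hi := inv_anti₀ (sigmoid_pos (2 * a * x)) hs
    have := mul_le_mul_of_nonneg_left hs (by positivity : 0 ≤ 4 * a ^ 2)
    simp only [hK]
    linarith
  have hcont : Continuous K := by
    have hs : Continuous fun y ↦ sigmoid (2 * a * y) := continuous_sigmoid.comp (by fun_prop)
    exact ((hs.inv₀ fun y ↦ (sigmoid_pos _).ne').sub (by fun_prop)).sub (by fun_prop)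
  have hl : 0 ≤ K (-(4 * a)) := by
    have h0 := sigmoid_pos (2 * a * -(4 * a))
    have h1 := sigmoid_le_one (2 * a * -(4 * a))
    have hi := inv_nonneg.2 h0.le
    have := mul_le_mul_of_nonneg_left h1 (by positivity : 0 ≤ 4 * a ^ 2)
    simp only [hK]
    linarith
  have hr : K ((2 + 8 * a ^ 2) / (2 * a)) ≤ 0 := by
    have hu : 2 * a * ((2 + 8 * a ^ 2) / (2 * a)) = 2 + 8 * a ^ 2 := by field_simp
    simp only [hK, hu]
    have hhalf : 2⁻¹ ≤ sigmoid (2 + 8 * a ^ 2) := by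
      rw [← sigmoid_zero]
      exact sigmoid_le (by positivity)
    have hi := inv_anti₀ (by norm_num) hhalf
    rw [inv_inv] at hi
    have := mul_le_mul_of_nonneg_left hhalf (by positivity : 0 ≤ 4 * a ^ 2)
    linarith [sq_nonneg a]
  obtain ⟨y₀, hy₀⟩ := mem_range_of_exists_le_of_exists_ge hcont ⟨_, hr⟩ ⟨_, hl⟩
  refine ⟨y₀, fun y hy ↦ ?_, fun y hy ↦ ?_⟩ <;> rw [hfac]
  · exact mul_nonneg (hw y) (hy₀ ▸ hanti hy)
  · exact mul_nonpos_of_nonneg_of_nonpos (hw y) (hy₀ ▸ hanti hy)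

/-- At a maximizer of `Gfun`, the regret of the logistic rule is stationary. -/
lemma integral_regretScore_eq_zero {a : ℝ} (ha : 0 < a)
    (hmax : ∀ τ : ℝ, 0 ≤ τ → Gfun τ ≤ Gfun a) :
    ∫ y, regretScore a y ∂(gaussianReal a 1) = 0 := by
  have hG := (differentiableAt_Gfun a).hasDerivAt
  have hGmax : IsLocalMax Gfun a :=
    Filter.eventually_of_mem (Ioi_mem_nhds ha) fun τ hτ ↦ hmax τ (le_of_lt hτ)
  have hg := hasDerivAt_sq_mul_sqErr a a
  have hmin : IsLocalMin ((fun t ↦ t ^ 2 * sqErr a t) - Gfun) a := by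
    refine Filter.Eventually.of_forall fun τ ↦ ?_
    simp only [Pi.sub_apply, Gfun_eq, sub_self, sub_nonneg]
    exact mul_le_mul_of_nonneg_left (sqErr_self_le a τ) (sq_nonneg τ)
  have h := hmin.hasDerivAt_eq_zero (hg.sub hG)
  rw [hGmax.hasDerivAt_eq_zero hG, sub_zero] at h
  exact (mul_eq_zero.1 h).resolve_left ha.ne'

/-- At a maximizer of `Gfun`, the regret of the logistic rule is maximal at its own parameter. -/
lemma sq_mul_sqErr_le_Gfun {a : ℝ} (ha : 0 < a)
    (hmax : ∀ τ : ℝ, 0 ≤ τ → Gfun τ ≤ Gfun a) {τ : ℝ} (hτ : 0 ≤ τ) :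
    τ ^ 2 * sqErr a τ ≤ Gfun a := by
  obtain ⟨y₀, hpos, hneg⟩ := exists_regretScore_sign ha
  have hsign := integral_gaussianReal_sign (integrable_regretScore a) hpos hneg
    (integral_regretScore_eq_zero ha hmax)
  have hd := hasDerivAt_sq_mul_sqErr a
  have hc : Continuous fun t ↦ t ^ 2 * sqErr a t :=
    continuous_iff_continuousAt.2 fun t ↦ (hd t).continuousAt
  have hdiff : ∀ s, DifferentiableOn ℝ (fun t ↦ t ^ 2 * sqErr a t) s :=
    fun s t _ ↦ (hd t).differentiableAt.differentiableWithinAt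
  rw [Gfun_eq]
  rcases le_total τ a with h | h
  · refine monotoneOn_of_deriv_nonneg (convex_Icc 0 a) hc.continuousOn (hdiff _) (fun t ht ↦ ?_)
      ⟨hτ, h⟩ ⟨ha.le, le_rfl⟩ h
    rw [interior_Icc] at ht
    rw [(hd t).deriv]
    exact mul_nonneg ht.1.le (nonneg_of_mul_nonpos_right (hsign t) (sub_neg.2 ht.2))
  · refine antitoneOn_of_deriv_nonpos (convex_Ici a) hc.continuousOn (hdiff _) (fun t ht ↦ ?_)
      Set.self_mem_Ici h h
    rw [interior_Ici] at ht
    rw [(hd t).deriv]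
    exact mul_nonpos_of_nonneg_of_nonpos (ha.trans ht).le
      (nonpos_of_mul_nonpos_right (hsign t) (sub_pos.2 ht))

lemma Rsq_of_nonneg (δ : ℝ → ℝ) {τ : ℝ} (hτ : 0 ≤ τ) :
    Rsq δ τ = τ ^ 2 * ∫ y, (1 - δ y) ^ 2 ∂(gaussianReal τ 1) := by
  simp [Rsq, hτ]

lemma Rsq_of_neg (δ : ℝ → ℝ) {τ : ℝ} (hτ : τ < 0) :
    Rsq δ τ = τ ^ 2 * ∫ y, δ y ^ 2 ∂(gaussianReal τ 1) := by
  simp [Rsq, hτ.not_ge]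

open Real in
/-- The regret of the logistic rule is symmetric in the state. -/
lemma Rsq_logisticRule (a τ : ℝ) : Rsq (logisticRule a) τ = |τ| ^ 2 * sqErr a |τ| := by
  rcases le_or_gt 0 τ with h | h
  · simp only [Rsq_of_nonneg _ h, logisticRule_eq_sigmoid, abs_of_nonneg h, sqErr]
  · rw [Rsq_of_neg _ h, abs_of_neg h, sqErr, integral_gaussianReal_neg]
    simp only [logisticRule_eq_sigmoid, mul_neg, sigmoid_neg, sub_sub_cancel, neg_sq]

/-- If `τ* > 0` maximizes `G` over `[0,∞)`, the logistic rule with parameter `τ*` is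
minimax optimal: its worst-case mean square regret is no larger than that of any
measurable `[0,1]`-valued rule (expressed via upper bounds `M`, i.e.
`sup_τ R_sq(δ*,τ) ≤ sup_τ R_sq(δ,τ)`). -/
theorem stmt15 (τs : ℝ) (hτs : 0 < τs)
    (hmax : ∀ τ : ℝ, 0 ≤ τ → Gfun τ ≤ Gfun τs) :
    ∀ δ : ℝ → ℝ, Measurable δ → (∀ y, δ y ∈ Set.Icc (0:ℝ) 1) →
      ∀ M : ℝ, (∀ τ, Rsq δ τ ≤ M) → ∀ τ, Rsq (logisticRule τs) τ ≤ M := by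
  intro δ hδ h01 M hM τ
  rw [Rsq_logisticRule]
  refine (sq_mul_sqErr_le_Gfun hτs hmax (abs_nonneg τ)).trans ?_
  have h1 := hM τs
  have h2 := hM (-τs)
  rw [Rsq_of_nonneg _ hτs.le] at h1
  rw [Rsq_of_neg _ (neg_neg_of_pos hτs), neg_sq] at h2
  have h3 := mul_le_mul_of_nonneg_left (two_mul_sqErr_le hδ h01 τs) (sq_nonneg τs)
  rw [Gfun_eq]
  linarith
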